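/- Let β ∈ (1,2) and λ ∈ ℂ with λ ≠ 0. Define u(x,y) = x E_{β,2}(−λ x^β) · y E_{β,2}(λ y^β) / λ on the square [0,1] × [0,1]. Then u satisfies the space-fractional elliptic equation (D_{0,x}^β u)(x,y) + (D_{0,y}^β u)(x,y) = 0 for all (x,y) ∈ (0,1] × (0,1], where D_{0,x}^β and D_{0,y}^β are the left-sided Djrbashian–Caputo fractional derivatives of order β in x and in y respectively, together with the Cauchy data u(x,0) = 0 and ∂u/∂y(x,0) = x E_{β,2}(−λ x^β)/λ for x ∈ (0,1). (These are the separable solutions used to exhibit the ill-posedness of the Cauchy problem for the fractional elliptic equation.) -/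

import Mathlib

open scoped Real

/-- Two-parameter Mittag-Leffler function (complex argument). -/
noncomputable def mlC (a b : ℝ) (z : ℂ) : ℂ :=
  ∑' k : ℕ, z ^ k / Complex.Gamma (((k : ℝ) * a + b : ℝ) : ℂ)

/-- Two-parameter Mittag-Leffler function (real argument). -/
noncomputable def mlR (a b : ℝ) (x : ℝ) : ℝ :=
  ∑' k : ℕ, x ^ k / Real.Gamma ((k : ℝ) * a + b)

/-- Wright function (real argument). -/
noncomputable def wrightR (p m : ℝ) (x : ℝ) : ℝ :=
  ∑' k : ℕ, x ^ k / ((k.factorial : ℝ) * Real.Gamma (p * (k : ℝ) + m))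

/-- Djrbashian-Caputo fractional derivative of order `g ∈ (0,1)` (real-valued). -/
noncomputable def caputoR (g : ℝ) (f : ℝ → ℝ) (t : ℝ) : ℝ :=
  (1 / Real.Gamma (1 - g)) * ∫ s in (0:ℝ)..t, (t - s) ^ (-g) * deriv f s

/-- Djrbashian-Caputo fractional derivative of order `b ∈ (1,2)` (complex-valued). -/
noncomputable def caputoC2 (b : ℝ) (f : ℝ → ℂ) (x : ℝ) : ℂ :=
  (1 / Complex.Gamma ((2 - b : ℝ) : ℂ)) *
    ∫ s in (0:ℝ)..x, (((x - s) ^ (1 - b) : ℝ) : ℂ) * deriv (deriv f) s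

/-- Riemann–Liouville fractional derivative of order `b ∈ (1,2)` (complex-valued). -/
noncomputable def rlC2 (b : ℝ) (f : ℝ → ℂ) (x : ℝ) : ℂ :=
  deriv (deriv (fun y : ℝ =>
    (1 / Complex.Gamma ((2 - b : ℝ) : ℂ)) *
      ∫ s in (0:ℝ)..y, (((y - s) ^ (1 - b) : ℝ) : ℂ) * f s)) x

/-- Separable solution of the space-fractional elliptic Cauchy problem. -/
noncomputable def u19 (β : ℝ) (lam : ℂ) (x y : ℝ) : ℂ :=
  (x : ℂ) * mlC β 2 (-lam * ((x ^ β : ℝ) : ℂ)) *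
    ((y : ℂ) * mlC β 2 (lam * ((y ^ β : ℝ) : ℂ))) / lam

/-- The `k`-th term `μ ^ k s ^ (kβ + γ - 1) / Γ(kβ + γ)` of `s ^ (γ - 1) E_{β,γ}(μ s ^ β)`. -/
noncomputable def mlTerm (β : ℝ) (μ : ℂ) (γ : ℝ) (k : ℕ) (s : ℝ) : ℂ :=
  μ ^ k * ((s ^ ((k : ℝ) * β + γ - 1) / Real.Gamma ((k : ℝ) * β + γ) : ℝ) : ℂ)

theorem summable_pow_div_abs_Gamma {β γ R : ℝ} (hβ : 1 ≤ β) (hγ : 0 ≤ γ) (hR : 0 ≤ R) :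
    Summable fun k : ℕ => R ^ k / |Real.Gamma ((k : ℝ) * β + γ)| := by
  rw [← summable_nat_add_iff 2]
  have h := (summable_nat_add_iff 1).2 (Real.summable_pow_div_factorial R)
  refine Summable.of_nonneg_of_le (fun k => by positivity) (fun k => ?_) (h.mul_left R)
  have hk : ((k + 1 : ℕ) : ℝ) + 1 ≤ ((k + 2 : ℕ) : ℝ) * β + γ := by
    push_cast
    nlinarith [(Nat.cast_nonneg k : (0 : ℝ) ≤ k)]
  have hk2 : (2 : ℝ) ≤ ((k + 1 : ℕ) : ℝ) + 1 := by
    push_cast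
    linarith [(Nat.cast_nonneg k : (0 : ℝ) ≤ k)]
  have hG := Real.Gamma_strictMonoOn_Ici.monotoneOn hk2 (hk2.trans hk) hk
  rw [Real.Gamma_nat_eq_factorial] at hG
  calc R ^ (k + 2) / |Real.Gamma (((k + 2 : ℕ) : ℝ) * β + γ)|
      ≤ R ^ (k + 2) / ((k + 1).factorial : ℝ) := by
        gcongr
        exact hG.trans (le_abs_self _)
    _ = R * (R ^ (k + 1) / ((k + 1).factorial : ℝ)) := by ring

theorem norm_mlTerm_le {β γ r s : ℝ} (μ : ℂ) (k : ℕ) (hβ : 1 ≤ β) (hγ : γ = 0 ∨ 1 ≤ γ)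
    (hr : 1 ≤ r) (hs : 0 < s) (hsr : s ≤ r) :
    ‖mlTerm β μ γ k s‖ ≤
      r ^ γ * ((‖μ‖ * r ^ β) ^ k / |Real.Gamma ((k : ℝ) * β + γ)|) := by
  have hr0 : 0 < r := by linarith
  rw [mlTerm, norm_mul, norm_pow, Complex.norm_real, Real.norm_eq_abs, abs_div,
    abs_of_pos (Real.rpow_pos_of_pos hs _)]
  have key : r ^ γ * ((‖μ‖ * r ^ β) ^ k / |Real.Gamma ((k : ℝ) * β + γ)|) =
      ‖μ‖ ^ k * (r ^ ((k : ℝ) * β + γ) / |Real.Gamma ((k : ℝ) * β + γ)|) := by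
    rw [Real.rpow_add hr0, mul_comm (k : ℝ) β, Real.rpow_mul hr0.le, Real.rpow_natCast, mul_pow]
    ring
  rw [key]
  rcases eq_or_ne ((k : ℝ) * β + γ) 0 with h0 | h0
  · simp [h0, Real.Gamma_zero]
  have he : 0 ≤ (k : ℝ) * β + γ - 1 := by
    rcases hγ with rfl | hγ
    · rcases Nat.eq_zero_or_pos k with rfl | hk
      · simp at h0
      · have : (1 : ℝ) ≤ k := by exact_mod_cast hk
        nlinarith
    · have : 0 ≤ (k : ℝ) * β := by positivity
      linarith
  gcongr
  calc s ^ ((k : ℝ) * β + γ - 1) ≤ r ^ ((k : ℝ) * β + γ - 1) :=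
        Real.rpow_le_rpow hs.le hsr he
    _ ≤ r ^ ((k : ℝ) * β + γ) := Real.rpow_le_rpow_of_exponent_le hr (by linarith)

theorem summable_mlTerm_bound {β γ r : ℝ} (μ : ℂ) (hβ : 1 ≤ β) (hγ : 0 ≤ γ) (hr : 1 ≤ r) :
    Summable fun k : ℕ => r ^ γ * ((‖μ‖ * r ^ β) ^ k / |Real.Gamma ((k : ℝ) * β + γ)|) :=
  (summable_pow_div_abs_Gamma hβ hγ
    (mul_nonneg (norm_nonneg _) (Real.rpow_nonneg (by linarith) _))).mul_left _

theorem summable_mlTerm {β γ s : ℝ} (μ : ℂ) (hβ : 1 ≤ β) (hγ : γ = 0 ∨ 1 ≤ γ) (hs : 0 < s) :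
    Summable fun k => mlTerm β μ γ k s :=
  .of_norm_bounded
    (summable_mlTerm_bound (r := s + 1) μ hβ (by rcases hγ with h | h <;> linarith) (by linarith))
    fun k => norm_mlTerm_le μ k hβ hγ (by linarith) hs (by linarith)

theorem hasDerivAt_mlTerm {β γ s : ℝ} (μ : ℂ) (k : ℕ) (hs : 0 < s) :
    HasDerivAt (mlTerm β μ (γ + 1) k) (mlTerm β μ γ k s) s := by
  unfold mlTerm
  refine (HasDerivAt.ofReal_comp ?_).const_mul _
  have h := (Real.hasDerivAt_rpow_const (p := (k : ℝ) * β + (γ + 1) - 1) (.inl hs.ne')).div_const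
    (Real.Gamma ((k : ℝ) * β + (γ + 1)))
  refine h.congr_deriv ?_
  rw [show (k : ℝ) * β + (γ + 1) - 1 = (k : ℝ) * β + γ by ring,
    show (k : ℝ) * β + (γ + 1) = (k : ℝ) * β + γ + 1 by ring]
  rcases eq_or_ne ((k : ℝ) * β + γ) 0 with h0 | h0
  · simp [h0, Real.Gamma_zero]
  · rw [Real.Gamma_add_one h0, mul_div_mul_left _ _ h0]

theorem hasDerivAt_tsum_mlTerm {β γ s : ℝ} (μ : ℂ) (hβ : 1 ≤ β) (hγ : γ = 0 ∨ 1 ≤ γ)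
    (hs : 0 < s) :
    HasDerivAt (fun t => ∑' k, mlTerm β μ (γ + 1) k t) (∑' k, mlTerm β μ γ k s) s := by
  have hγ0 : 0 ≤ γ := by rcases hγ with h | h <;> linarith
  have hmem : s ∈ Set.Ioo 0 (s + 1) := ⟨hs, by linarith⟩
  exact hasDerivAt_tsum_of_isPreconnected
    (summable_mlTerm_bound (r := s + 1) μ hβ hγ0 (by linarith)) isOpen_Ioo isPreconnected_Ioo
    (fun k t ht => hasDerivAt_mlTerm μ k ht.1)
    (fun k t ht => norm_mlTerm_le μ k hβ hγ (by linarith) ht.1 ht.2.le) hmem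
    (summable_mlTerm μ hβ (.inr (by linarith)) hs) hmem

theorem mul_mlC_eq_tsum {β s : ℝ} (μ : ℂ) (hs : 0 < s) :
    (s : ℂ) * mlC β 2 (μ * ((s ^ β : ℝ) : ℂ)) = ∑' k, mlTerm β μ 2 k s := by
  rw [mlC, ← tsum_mul_left]
  refine tsum_congr fun k => ?_
  rw [mlTerm, Complex.Gamma_ofReal, mul_pow, show (k : ℝ) * β + 2 - 1 = β * k + 1 by ring,
    Real.rpow_add hs, Real.rpow_mul hs.le, Real.rpow_natCast, Real.rpow_one]
  push_cast
  ring

theorem deriv_deriv_mul_mlC {β s : ℝ} (μ : ℂ) (hβ : 1 ≤ β) (hs : 0 < s) :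
    deriv (deriv fun t : ℝ => (t : ℂ) * mlC β 2 (μ * ((t ^ β : ℝ) : ℂ))) s =
      ∑' k, mlTerm β μ 0 k s := by
  have h1 : ∀ t : ℝ, 0 < t →
      deriv (fun t : ℝ => (t : ℂ) * mlC β 2 (μ * ((t ^ β : ℝ) : ℂ))) t =
        ∑' k, mlTerm β μ 1 k t := by
    intro t ht
    have h := hasDerivAt_tsum_mlTerm (γ := 1) μ hβ (.inr le_rfl) ht
    rw [one_add_one_eq_two] at h
    refine (h.congr_of_eventuallyEq ?_).deriv
    filter_upwards [lt_mem_nhds ht] with a ha using mul_mlC_eq_tsum μ ha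
  have h := hasDerivAt_tsum_mlTerm (γ := 0) μ hβ (.inl rfl) hs
  rw [zero_add] at h
  refine (h.congr_of_eventuallyEq ?_).deriv
  filter_upwards [lt_mem_nhds hs] with a ha using h1 a ha

theorem intervalIntegrable_sub_rpow {a x : ℝ} (ha : -1 < a) :
    IntervalIntegrable (fun s : ℝ => (x - s) ^ a) MeasureTheory.volume 0 x := by
  have h := (intervalIntegral.intervalIntegrable_rpow' (a := 0) (b := x) ha).comp_sub_left x
  simpa using h.symm

theorem integral_sub_rpow_mul_rpow {a b x : ℝ} (ha : 0 < a) (hb : 0 < b) (hx : 0 < x) :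
    ∫ s in (0 : ℝ)..x, (x - s) ^ (a - 1) * s ^ (b - 1) =
      x ^ (a + b - 1) * (Real.Gamma a * Real.Gamma b / Real.Gamma (a + b)) := by
  have h := Complex.betaIntegral_scaled b a hx
  rw [Complex.betaIntegral_eq_Gamma_mul_div _ _ (by simpa) (by simpa)] at h
  apply Complex.ofReal_injective
  rw [← intervalIntegral.integral_ofReal]
  convert h using 1
  · refine intervalIntegral.integral_congr_ae (.of_forall fun s hs => ?_)
    rw [Set.uIoc_of_le hx.le] at hs
    push_cast
    rw [Complex.ofReal_cpow (by linarith [hs.2]), Complex.ofReal_cpow hs.1.le]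
    push_cast
    ring
  · push_cast
    rw [Complex.ofReal_cpow hx.le, ← Complex.Gamma_ofReal, ← Complex.Gamma_ofReal,
      ← Complex.Gamma_ofReal]
    push_cast
    rw [add_comm (b : ℂ) a, mul_comm (Complex.Gamma b)]

theorem integral_sub_rpow_mul_mlTerm_succ {β x : ℝ} (μ : ℂ) (k : ℕ) (hβ : β ∈ Set.Ioo (1 : ℝ) 2)
    (hx : 0 < x) :
    ∫ s in (0 : ℝ)..x, (((x - s) ^ (1 - β) : ℝ) : ℂ) * mlTerm β μ 0 (k + 1) s =
      Complex.Gamma ((2 - β : ℝ) : ℂ) * (μ * mlTerm β μ 2 k x) := by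
  obtain ⟨h1, h2⟩ := hβ
  have hb : 0 < ((k + 1 : ℕ) : ℝ) * β + 0 := by positivity
  have hI := integral_sub_rpow_mul_rpow (a := 2 - β) (by linarith) hb hx
  have hG := (Real.Gamma_pos_of_pos hb).ne'
  have hI' : ∫ s in (0 : ℝ)..x, (x - s) ^ (1 - β) *
      (s ^ (((k + 1 : ℕ) : ℝ) * β + 0 - 1) / Real.Gamma (((k + 1 : ℕ) : ℝ) * β + 0)) =
      Real.Gamma (2 - β) * (x ^ ((k : ℝ) * β + 2 - 1) / Real.Gamma ((k : ℝ) * β + 2)) := by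
    simp_rw [← mul_div_assoc]
    rw [intervalIntegral.integral_div, show 1 - β = 2 - β - 1 by ring, hI,
      show 2 - β + (((k + 1 : ℕ) : ℝ) * β + 0) = (k : ℝ) * β + 2 by push_cast; ring]
    field_simp
  have := congrArg (fun r : ℝ => μ ^ (k + 1) * (r : ℂ)) hI'
  simp only [← intervalIntegral.integral_ofReal, ← intervalIntegral.integral_const_mul] at this
  rw [Complex.Gamma_ofReal]
  convert this using 1
  · refine intervalIntegral.integral_congr fun s _ => ?_
    simp only [mlTerm]
    push_cast
    ring
  · simp only [mlTerm]
    push_cast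
    ring

theorem caputoC2_mul_mlC {β x : ℝ} (μ : ℂ) (hβ : β ∈ Set.Ioo (1 : ℝ) 2) (hx : 0 < x) :
    caputoC2 β (fun s : ℝ => (s : ℂ) * mlC β 2 (μ * ((s ^ β : ℝ) : ℂ))) x =
      μ * ((x : ℂ) * mlC β 2 (μ * ((x ^ β : ℝ) : ℂ))) := by
  have hβ1 : 1 ≤ β := hβ.1.le
  have hker := intervalIntegrable_sub_rpow (a := 1 - β) (x := x) (by linarith [hβ.2])
  have hpos : ∀ s ∈ Set.uIoc 0 x, 0 < s ∧ s ≤ x := fun s hs => by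
    rwa [Set.uIoc_of_le hx.le] at hs
  have hbd := summable_mlTerm_bound (r := x + 1) μ hβ1 le_rfl (by linarith)
  have hmeas : ∀ k, MeasureTheory.AEStronglyMeasurable
      (fun s : ℝ => (((x - s) ^ (1 - β) : ℝ) : ℂ) * mlTerm β μ 0 k s)
      (MeasureTheory.volume.restrict (Set.uIoc 0 x)) := fun k => by
    unfold mlTerm
    exact Measurable.aestronglyMeasurable (by fun_prop)
  have hsum := intervalIntegral.hasSum_integral_of_dominated_convergence
    (f := fun s => (((x - s) ^ (1 - β) : ℝ) : ℂ) * ∑' k, mlTerm β μ 0 k s)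
    (fun (k : ℕ) s => (x - s) ^ (1 - β) *
      ((x + 1) ^ (0 : ℝ) * ((‖μ‖ * (x + 1) ^ β) ^ k / |Real.Gamma ((k : ℝ) * β + 0)|)))
    hmeas
    (fun k => .of_forall fun s hs => by
      obtain ⟨hs0, hsx⟩ := hpos s hs
      have hn : 0 ≤ (x - s) ^ (1 - β) := Real.rpow_nonneg (by linarith) _
      rw [norm_mul, Complex.norm_real, Real.norm_of_nonneg hn]
      exact mul_le_mul_of_nonneg_left
        (norm_mlTerm_le μ k hβ1 (.inl rfl) (by linarith) hs0 (by linarith)) hn)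
    (.of_forall fun s _ => hbd.mul_left _)
    (by simp_rw [tsum_mul_left]; exact hker.mul_const _)
    (.of_forall fun s hs =>
      (summable_mlTerm μ hβ1 (.inl rfl) (hpos s hs).1).hasSum.mul_left _)
  have hzero : ∫ s in (0 : ℝ)..x, (((x - s) ^ (1 - β) : ℝ) : ℂ) * mlTerm β μ 0 0 s = 0 := by
    simp [mlTerm, Real.Gamma_zero]
  have hG : Complex.Gamma ((2 - β : ℝ) : ℂ) ≠ 0 := by
    rw [Complex.Gamma_ofReal]
    exact_mod_cast (Real.Gamma_pos_of_pos (by linarith [hβ.2])).ne'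
  have h_integral : ∫ s in (0 : ℝ)..x, (((x - s) ^ (1 - β) : ℝ) : ℂ) *
      deriv (deriv fun t : ℝ => (t : ℂ) * mlC β 2 (μ * ((t ^ β : ℝ) : ℂ))) s =
      ∫ s in (0 : ℝ)..x, (((x - s) ^ (1 - β) : ℝ) : ℂ) * ∑' k, mlTerm β μ 0 k s :=
    intervalIntegral.integral_congr_ae (.of_forall fun s hs => by
      rw [deriv_deriv_mul_mlC μ hβ1 (hpos s hs).1])
  rw [caputoC2, h_integral, ← hsum.tsum_eq, hsum.summable.tsum_eq_zero_add, hzero, zero_add]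
  simp_rw [integral_sub_rpow_mul_mlTerm_succ μ _ hβ hx]
  rw [tsum_mul_left, tsum_mul_left, mul_mlC_eq_tsum μ hx]
  field_simp

theorem caputoC2_const_mul (β : ℝ) (c : ℂ) (f : ℝ → ℂ) (x : ℝ) :
    caputoC2 β (fun s => c * f s) x = c * caputoC2 β f x := by
  have h : deriv (fun s => c * f s) = fun s => c * deriv f s :=
    funext fun s => deriv_const_mul_field c
  have h2 : deriv (deriv fun s => c * f s) = fun s => c * deriv (deriv f) s := by
    rw [h]
    exact funext fun s => deriv_const_mul_field c
  simp only [caputoC2, h2, mul_left_comm _ c, intervalIntegral.integral_const_mul]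

theorem mlC_two_zero (β : ℝ) : mlC β 2 0 = 1 := by
  rw [mlC, tsum_eq_single 0 fun k hk => by simp [hk]]
  simp

theorem continuousAt_mlC_two_zero {β : ℝ} (hβ : 1 ≤ β) : ContinuousAt (mlC β 2) 0 := by
  have h : ContinuousOn (mlC β 2) (Metric.ball 0 1) := by
    refine continuousOn_tsum (fun k => by fun_prop)
      (summable_pow_div_abs_Gamma hβ zero_le_two zero_le_one) fun k z hz => ?_
    rw [Complex.Gamma_ofReal, norm_div, norm_pow, Complex.norm_real, Real.norm_eq_abs]
    gcongr
    exact (mem_ball_zero_iff.1 hz).le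
  exact h.continuousAt (Metric.ball_mem_nhds 0 one_pos)

theorem hasDerivAt_ofReal_mul_zero {g : ℝ → ℂ} (hg : ContinuousAt g 0) :
    HasDerivAt (fun y : ℝ => (y : ℂ) * g y) (g 0) 0 := by
  rw [hasDerivAt_iff_tendsto_slope]
  refine (hg.tendsto.mono_left nhdsWithin_le_nhds).congr' ?_
  filter_upwards [self_mem_nhdsWithin] with y hy
  have hy : (y : ℂ) ≠ 0 := by exact_mod_cast hy
  simp [slope, hy]

/-- `u(x,y) = x E_{β,2}(−λx^β) · y E_{β,2}(λy^β)/λ` solves the fractional elliptic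
equation `D_{0,x}^β u + D_{0,y}^β u = 0` with Cauchy data `u(x,0) = 0`,
`u_y(x,0) = x E_{β,2}(−λx^β)/λ`. -/
theorem stmt_19 (β : ℝ) (hβ : β ∈ Set.Ioo (1:ℝ) 2) (lam : ℂ) (hlam : lam ≠ 0) :
    (∀ x ∈ Set.Ioc (0:ℝ) 1, ∀ y ∈ Set.Ioc (0:ℝ) 1,
      caputoC2 β (fun s => u19 β lam s y) x + caputoC2 β (fun s => u19 β lam x s) y = 0) ∧
    (∀ x ∈ Set.Ioo (0:ℝ) 1,
      u19 β lam x 0 = 0 ∧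
      deriv (fun y => u19 β lam x y) 0 =
        (x : ℂ) * mlC β 2 (-lam * ((x ^ β : ℝ) : ℂ)) / lam) := by
  have hβ1 : 1 ≤ β := hβ.1.le
  refine ⟨fun x hx y hy => ?_, fun x _ => ⟨by simp [u19], ?_⟩⟩
  · have h1 : (fun s => u19 β lam s y) = fun s : ℝ =>
        ((y : ℂ) * mlC β 2 (lam * ((y ^ β : ℝ) : ℂ)) / lam) *
          ((s : ℂ) * mlC β 2 (-lam * ((s ^ β : ℝ) : ℂ))) := by
      funext s
      rw [u19]
      ring
    have h2 : (fun s => u19 β lam x s) = fun s : ℝ =>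
        ((x : ℂ) * mlC β 2 (-lam * ((x ^ β : ℝ) : ℂ)) / lam) *
          ((s : ℂ) * mlC β 2 (lam * ((s ^ β : ℝ) : ℂ))) := by
      funext s
      rw [u19]
      ring
    rw [h1, h2, caputoC2_const_mul, caputoC2_const_mul, caputoC2_mul_mlC _ hβ hx.1,
      caputoC2_mul_mlC _ hβ hy.1]
    ring
  · have hβ0 : β ≠ 0 := by linarith
    have h0 : lam * (((0 : ℝ) ^ β : ℝ) : ℂ) = 0 := by simp [Real.zero_rpow hβ0]
    have hg : ContinuousAt (fun y : ℝ => mlC β 2 (lam * ((y ^ β : ℝ) : ℂ))) 0 := by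
      refine ContinuousAt.comp (g := mlC β 2) ?_ ?_
      · rw [h0]
        exact continuousAt_mlC_two_zero hβ1
      · exact continuousAt_const.mul (Complex.continuous_ofReal.continuousAt.comp
          (Real.continuousAt_rpow_const _ _ (.inr (by linarith))))
    have h := (hasDerivAt_ofReal_mul_zero hg).const_mul
      ((x : ℂ) * mlC β 2 (-lam * ((x ^ β : ℝ) : ℂ)))
    have h' := (h.div_const lam).deriv
    rw [h0, mlC_two_zero, mul_one] at h'
    exact h'
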